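/- arXiv:2302.05539 — 3 statements merged into one kernel-verified Lean document; each statement's English description precedes it below -/
import Mathlib

section
/- Suppose k ≤ k' ≤ l < ω and s ∈ FIN with max(s) = l. Suppose A ⊆ 2^{𝒫(l)} is (k',s)-big and t ∈ {0,1}. Then the set B = {τ ∈ A : for all u ⊆ {0,…,k−1} and all v ∈ FIN with k ≤ min(v) ≤ max(v) < k', τ(u ∪ v ∪ s⁻) = 1−t} is (k,s)-big. -/
open Set Filter

abbrev FIN : Type := {s : Finset ℕ // s.Nonempty}

def maxF (s : FIN) : ℕ := s.1.max' s.2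

def minF (s : FIN) : ℕ := s.1.min' s.2

/-- `s <_b t` iff `max s < min t`. -/
def blt (s t : FIN) : Prop := maxF s < minF t

/-- An infinite block sequence, presented as its increasing enumeration. -/
def IsBlockFun (X : ℕ → FIN) : Prop := ∀ i j : ℕ, i < j → blt (X i) (X j)

/-- A block sequence of length `n`. -/
def IsBlockSeqN {n : ℕ} (X : Fin n → FIN) : Prop :=
  ∀ i j : Fin n, i < j → blt (X i) (X j)

/-- `[X]` : all unions of finitely many (at least one) members of `X`. -/
def blocks (X : ℕ → FIN) : Set FIN :=
  {s | ∃ F : Finset ℕ, F.Nonempty ∧ s.1 = F.sup fun i => (X i).1}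

def IsOrderedUnion (H : Ultrafilter FIN) : Prop :=
  ∀ A : Set FIN, A ∈ H →
    ∃ X : ℕ → FIN, IsBlockFun X ∧ blocks X ∈ H ∧ blocks X ⊆ A

def IsStableOU (H : Ultrafilter FIN) : Prop :=
  IsOrderedUnion H ∧
    ∀ Xs : ℕ → ℕ → FIN, (∀ n, IsBlockFun (Xs n) ∧ blocks (Xs n) ∈ H) →
      ∃ Y : ℕ → FIN, IsBlockFun Y ∧ blocks Y ∈ H ∧
        ∀ n, ∀ᶠ i in atTop, Y i ∈ blocks (Xs n)

def IsSelective (U : Ultrafilter ℕ) : Prop :=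
  ∀ f : ℕ → ℕ, ∃ A : Set ℕ, A ∈ U ∧
    ((∀ x ∈ A, ∀ y ∈ A, f x = f y) ∨ Set.InjOn f A)

/-- `I(s) = {k : min s ≤ k ≤ max s}`. -/
def Iset (s : FIN) : Set ℕ := Set.Icc (minF s) (maxF s)

/-- `N(X) = ⋃ i, I(X(i))`. -/
def Nset (X : ℕ → FIN) : Set ℕ := ⋃ i, Iset (X i)

/-- Membership in the class `𝒞₀(ℋ)`. -/
def MemC0 (H : Ultrafilter FIN) (U : Ultrafilter ℕ) : Prop :=
  IsSelective U ∧
    ∀ X : ℕ → FIN, IsBlockFun X → blocks X ∈ H →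
      ∃ Y : ℕ → FIN, IsBlockFun Y ∧ blocks Y ∈ H ∧ blocks Y ⊆ blocks X ∧
        Nset Y ∉ U

def RKle (U V : Ultrafilter ℕ) : Prop := ∃ f : ℕ → ℕ, Ultrafilter.map f V = U

def RKequiv (U V : Ultrafilter ℕ) : Prop := RKle U V ∧ RKle V U

/-- Membership in the class `𝒞₁(ℋ)`. -/
def MemC1 (H : Ultrafilter FIN) (U : Ultrafilter ℕ) : Prop :=
  IsSelective U ∧
    ∀ V : Ultrafilter ℕ, IsSelective V → ¬ MemC0 H V → ¬ RKequiv U V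

def initSeg {α : Type _} (f : ℕ → α) (n : ℕ) : List α := (List.range n).map f

def interleave (a : ℕ → ℕ) (b : ℕ → FIN) (m : ℕ) : ℕ ⊕ FIN :=
  if m % 2 = 0 then Sum.inl (a (m / 2)) else Sum.inr (b (m / 2))

/-- Nodes of the tree `𝕋`: a node of length `l` is a sequence whose `k`-th entry
codes a function `𝒫(k) → 2` (coded as a total function `Finset ℕ → Bool`;
only values on subsets of `{0,…,k−1}` matter). -/
abbrev Node : Type := List (Finset ℕ → Bool)

/-- `s⁻ = s \ {max s}`. -/
def sm (s : FIN) : Finset ℕ := s.1.erase (maxF s)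

/-- `A` is `(k,s)`-big. -/
def IsBig (k : ℕ) (s : FIN) (A : Set (Finset ℕ → Bool)) : Prop :=
  ∀ σ : Finset ℕ → Bool, ∃ τ ∈ A, ∀ u ⊆ Finset.range k, σ u = τ (u ∪ sm s)

def succT (T : Set Node) (f : Node) : Set (Finset ℕ → Bool) := {τ | f ++ [τ] ∈ T}

/-- `H_{p,k}`. -/
def Hset (T : Set Node) (k : ℕ) : Set FIN :=
  {s | k ≤ maxF s ∧ ∀ f ∈ T, f.length = maxF s → IsBig k s (succT T f)}

/-- `T` is an `ℋ`-condition, i.e. a member of `ℙ(ℋ)`. -/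
def IsCond (H : Ultrafilter FIN) (T : Set Node) : Prop :=
  (∀ g ∈ T, ∀ n, g.take n ∈ T) ∧ ([] : Node) ∈ T ∧
    (∀ f ∈ T, ∀ n : ℕ, f.length ≤ n → ∃ g ∈ T, f <+: g ∧ n ≤ g.length) ∧
    ∀ k : ℕ, Hset T k ∈ H

/-- `T⟨f⟩`. -/
def Tsub (T : Set Node) (f : Node) : Set Node := {g ∈ T | f <+: g ∨ g <+: f}

/-- The constraint linking consecutive moves of Player I in `Γ^Cond(ℋ)`. -/
def StepOK (H : Ultrafilter FIN) (p : Set Node) (s : FIN) (p' : Set Node) : Prop :=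
  ∃ q : Node → Set Node,
    (∀ e ∈ p, e.length = maxF s + 1 → IsCond H (q e) ∧ q e ⊆ Tsub p e) ∧
    p' = ⋃ e ∈ {e : Node | e ∈ p ∧ e.length = maxF s + 1}, q e

/-- restriction of a big set: if `A` is `(k',s)`-big and
`t ∈ {0,1}` then `B = {τ ∈ A : τ(u ∪ v ∪ s⁻) = 1−t for all u ⊆ {0,…,k−1}` and
all `v ∈ FIN` with `k ≤ min v ≤ max v < k'}` is `(k,s)`-big. -/
theorem stmt16 (k k' l : ℕ) (hkk' : k ≤ k') (hk'l : k' ≤ l)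
    (s : FIN) (hs : maxF s = l) (A : Set (Finset ℕ → Bool))
    (hA : IsBig k' s A) (t : Bool) :
    IsBig k s
      {τ ∈ A | ∀ u ⊆ Finset.range k, ∀ v : FIN,
        k ≤ minF v → maxF v < k' → τ (u ∪ v.1 ∪ sm s) = !t} := by
  intro σ
  obtain ⟨τ, hτ, h⟩ := hA (fun u => if u ⊆ Finset.range k then σ u else !t)
  refine ⟨τ, ⟨hτ, ?_⟩, ?_⟩
  · intro u hu v hv1 hv2
    have hsub : u ∪ v.1 ⊆ Finset.range k' := by
      apply Finset.union_subset (hu.trans (Finset.range_subset_range.2 hkk'))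
      intro x hx
      exact Finset.mem_range.2 (lt_of_le_of_lt (Finset.le_max' v.1 x hx) hv2)
    have hn : ¬ (u ∪ v.1 ⊆ Finset.range k) := by
      intro hc
      have h1 : minF v ∈ Finset.range k :=
        hc (Finset.mem_union_right _ (Finset.min'_mem v.1 v.2))
      exact absurd (Finset.mem_range.1 h1) (not_lt.2 hv1)
    have h2 := h _ hsub
    simp only [if_neg hn] at h2
    exact h2.symm
  · intro u hu
    have h2 := h u (hu.trans (Finset.range_subset_range.2 hkk'))
    simp only [if_pos hu] at h2
    exact h2
end

section
/- Let ℋ be a stable ordered-union ultrafilter on FIN and let 𝒰 be a selective ultrafilter on ω with 𝒰 ∉ 𝒞₀(ℋ). Then for every L ∈ ℋ and every E ∈ 𝒰 there exist Y ∈ FIN^[ω] and D ⊆ E such that [Y] ∈ ℋ, [Y] ⊆ L, D ∈ 𝒰, and, letting (n_i)_{i∈ω} be the strictly increasing enumeration of D, n_i ∈ I(Y(i)) for every i ∈ ω. -/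
open Set Filter

theorem mem_blocks_self (Z : ℕ → FIN) (i : ℕ) : Z i ∈ blocks Z :=
  ⟨{i}, Finset.singleton_nonempty i, by simp⟩

theorem minF_le_maxF (s : FIN) : minF s ≤ maxF s :=
  Finset.min'_le_max' s.1 s.2

theorem le_minF_of_block (Z : ℕ → FIN) (hZ : IsBlockFun Z) (i : ℕ) : i ≤ minF (Z i) := by
  induction i with
  | zero => exact Nat.zero_le _
  | succ k ih =>
    have h1 : maxF (Z k) < minF (Z (k+1)) := hZ k (k+1) (Nat.lt_succ_self k)
    have h2 := minF_le_maxF (Z k)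
    omega

theorem large_mem (H : Ultrafilter FIN) (hH : IsOrderedUnion H) (m : ℕ) :
    {s : FIN | m < minF s} ∈ H := by
  by_contra h
  rw [← Ultrafilter.compl_mem_iff_notMem] at h
  obtain ⟨Z, hZ, -, hs⟩ := hH _ h
  have h1 := hs (mem_blocks_self Z (m+1))
  have h2 := le_minF_of_block Z hZ (m+1)
  simp only [Set.mem_compl_iff, Set.mem_setOf_eq] at h1
  omega

/-- if `𝒰` is selective and `𝒰 ∉ 𝒞₀(ℋ)`, then for every `L ∈ ℋ`
and `E ∈ 𝒰` there are `Y ∈ FIN^[ω]` and `D ⊆ E` with `[Y] ∈ ℋ`, `[Y] ⊆ L`,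
`D ∈ 𝒰`, and `n_i ∈ I(Y(i))` for all `i`, where `(n_i)` is the strictly
increasing enumeration of `D`. -/
theorem stmt17 (H : Ultrafilter FIN) (hH : IsStableOU H)
    (U : Ultrafilter ℕ) (hU : IsSelective U) (hU0 : ¬ MemC0 H U)
    (L : Set FIN) (hL : L ∈ H) (E : Set ℕ) (hE : E ∈ U) :
    ∃ (Y : ℕ → FIN) (e : ℕ → ℕ),
      IsBlockFun Y ∧ blocks Y ∈ H ∧ blocks Y ⊆ L ∧
      StrictMono e ∧ Set.range e ⊆ E ∧ Set.range e ∈ U ∧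
      ∀ i, e i ∈ Iset (Y i) := by
  classical
  have hU1 : ∃ X0 : ℕ → FIN, IsBlockFun X0 ∧ blocks X0 ∈ H ∧
      ∀ Y : ℕ → FIN, IsBlockFun Y → blocks Y ∈ H → blocks Y ⊆ blocks X0 → Nset Y ∈ U := by
    by_contra hcon
    apply hU0
    refine ⟨hU, fun X hX hXH => ?_⟩
    by_contra hc
    apply hcon
    refine ⟨X, hX, hXH, fun Y hY hYH hYX => ?_⟩
    by_contra hn
    exact hc ⟨Y, hY, hYH, hYX, hn⟩
  obtain ⟨X0, -, hX0H, hX0⟩ := hU1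
  have key : ∀ A : Set FIN, A ∈ H → ∃ Z : ℕ → FIN, IsBlockFun Z ∧ blocks Z ∈ H ∧
      blocks Z ⊆ A ∧ Nset Z ∈ U := by
    intro A hA
    obtain ⟨Z, hZ, hZH, hs⟩ := hH.1 _ (Filter.inter_mem hA hX0H)
    exact ⟨Z, hZ, hZH, fun s h => (hs h).1, hX0 Z hZ hZH fun s h => (hs h).2⟩
  have hhit : {s : FIN | ∃ n ∈ E, n ∈ Iset s} ∈ H := by
    by_contra h
    rw [← Ultrafilter.compl_mem_iff_notMem] at h
    obtain ⟨Z, hZ, -, hs, hN⟩ := key _ h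
    obtain ⟨n, hn, hnE⟩ := U.nonempty_of_mem (Filter.inter_mem hN hE)
    obtain ⟨i, hi⟩ := Set.mem_iUnion.1 hn
    exact hs (mem_blocks_self Z i) ⟨n, hnE, hi⟩
  obtain ⟨Y, hY, hYH, hYs, hYN⟩ := key _ (Filter.inter_mem hL hhit)
  have hYE : ∀ i, ∃ n ∈ E, n ∈ Iset (Y i) := fun i => (hYs (mem_blocks_self Y i)).2
  have hf : ∀ n, ∃ i, n ∈ Nset Y → n ∈ Iset (Y i) := by
    intro n
    by_cases h : n ∈ Nset Y
    · obtain ⟨i, hi⟩ := Set.mem_iUnion.1 h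
      exact ⟨i, fun _ => hi⟩
    · exact ⟨0, fun h' => absurd h' h⟩
  choose f hf using hf
  have huniq : ∀ n i j, n ∈ Iset (Y i) → n ∈ Iset (Y j) → i = j := by
    intro n i j hi hj
    rcases lt_trichotomy i j with h | h | h
    · have h1 : maxF (Y i) < minF (Y j) := hY i j h
      have h2 := hi.2
      have h3 := hj.1
      omega
    · exact h
    · have h1 : maxF (Y j) < minF (Y i) := hY j i h
      have h2 := hj.2
      have h3 := hi.1
      omega
  obtain ⟨B, hB, hBf⟩ := hU f
  have hD : (B ∩ Nset Y) ∩ E ∈ U := Filter.inter_mem (Filter.inter_mem hB hYN) hE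
  have hinj : Set.InjOn f B := by
    rcases hBf with hc | hinj
    · exfalso
      obtain ⟨a, ⟨haB, -⟩, -⟩ := U.nonempty_of_mem hD
      obtain ⟨Z, hZ, -, hs, hN⟩ := key _ (large_mem H hH.1 (maxF (Y (f a))))
      obtain ⟨n, hn, ⟨hnB, hnY⟩, -⟩ := U.nonempty_of_mem (Filter.inter_mem hN hD)
      obtain ⟨i, hi⟩ := Set.mem_iUnion.1 hn
      have h1 : maxF (Y (f a)) < minF (Z i) := hs (mem_blocks_self Z i)
      have h2 := (hf n hnY).2
      rw [hc n hnB a haB] at h2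
      have h3 := hi.1
      omega
    · exact hinj
  have he : ∀ i, ∃ n, n ∈ E ∧ n ∈ Iset (Y i) ∧
      ∀ m ∈ (B ∩ Nset Y) ∩ E, m ∈ Iset (Y i) → n = m := by
    intro i
    by_cases h : ∃ n ∈ (B ∩ Nset Y) ∩ E, n ∈ Iset (Y i)
    · obtain ⟨n, ⟨⟨hnB, hnY⟩, hnE⟩, hni⟩ := h
      refine ⟨n, hnE, hni, fun m hm hmi => hinj hnB hm.1.1 ?_⟩
      rw [huniq n _ _ (hf n hnY) hni, huniq m _ _ (hf m hm.1.2) hmi]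
    · obtain ⟨n, hn, hni⟩ := hYE i
      exact ⟨n, hn, hni, fun m hm hmi => absurd ⟨m, hm, hmi⟩ h⟩
  choose e heE heI heU using he
  refine ⟨Y, e, hY, hYH, fun s h => (hYs h).1, ?_, ?_, ?_, heI⟩
  · intro i j hij
    have h1 : maxF (Y i) < minF (Y j) := hY i j hij
    have h2 := (heI i).2
    have h3 := (heI j).1
    omega
  · rintro _ ⟨i, rfl⟩
    exact heE i
  · refine Filter.mem_of_superset hD fun m hm => ?_
    exact ⟨f m, heU (f m) m hm (hf m hm.1.2)⟩
end

section
/- Let ℋ be a stable ordered-union ultrafilter on FIN and let 𝒰 be a selective ultrafilter on ω with 𝒰 ∉ 𝒞₀(ℋ). Then for every L ∈ ℋ and every E ∈ 𝒰, the set {s ∈ L : I(s) ∩ E ≠ ∅} belongs to ℋ. -/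
open Set Filter

/-- if `𝒰` is selective and `𝒰 ∉ 𝒞₀(ℋ)`, then for every `L ∈ ℋ`
and `E ∈ 𝒰`, the set `{s ∈ L : I(s) ∩ E ≠ ∅}` belongs to `ℋ`. -/
theorem stmt18 (H : Ultrafilter FIN) (hH : IsStableOU H)
    (U : Ultrafilter ℕ) (hU : IsSelective U) (hU0 : ¬ MemC0 H U)
    (L : Set FIN) (hL : L ∈ H) (E : Set ℕ) (hE : E ∈ U) :
    {s ∈ L | (Iset s ∩ E).Nonempty} ∈ H := by
  by_contra hcon
  apply hU0
  refine ⟨hU, fun X _ hX => ?_⟩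
  have h1 : {s ∈ L | (Iset s ∩ E).Nonempty}ᶜ ∈ H := Ultrafilter.compl_mem_iff_notMem.mpr hcon
  have h2 : {s ∈ L | (Iset s ∩ E).Nonempty}ᶜ ∩ L ∩ blocks X ∈ H :=
    Filter.inter_mem (Filter.inter_mem h1 hL) hX
  obtain ⟨Y, hY, hYH, hYs⟩ := hH.1 _ h2
  refine ⟨Y, hY, hYH, fun s hs => (hYs hs).2, fun hN => ?_⟩
  obtain ⟨k, hk, hkE⟩ := Ultrafilter.nonempty_of_mem (Filter.inter_mem hN hE)
  obtain ⟨i, hi⟩ := Set.mem_iUnion.mp hk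
  have hm : Y i ∈ blocks Y := ⟨{i}, Finset.singleton_nonempty i, by simp⟩
  exact (hYs hm).1.1 ⟨(hYs hm).1.2, k, hi, hkE⟩
end
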